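/- Let a₀,…,a_r be self-adjoint m×m matrices, let x₁,…,x_r be self-adjoint elements of a unital C*-algebra B with a state τ, and set s = a₀ ⊗ 1 + Σᵢ aᵢ ⊗ xᵢ ∈ M_m(ℂ) ⊗ B. For λ ∈ M_m(ℂ) with Im λ positive definite, the element λ ⊗ 1 - s is invertible, and with G(λ) = (id_m ⊗ τ)[(λ⊗1 - s)⁻¹], one has -Im G(λ) ≥ (‖λ⊗1 - s‖² · ‖(Im λ)⁻¹‖)⁻¹ · 1_m; in particular G(λ) is invertible with ‖G(λ)⁻¹‖ ≤ ‖λ⊗1 - s‖² · ‖(Im λ)⁻¹‖. -/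

import Mathlib

open scoped ComplexOrder

/-- The imaginary part `Im λ = (λ - λ*)/(2i)` of a square complex matrix. -/
noncomputable def matIm {m : ℕ} (lam : Matrix (Fin m) (Fin m) ℂ) : Matrix (Fin m) (Fin m) ℂ :=
  (2 * Complex.I)⁻¹ • (lam - lam.conjTranspose)

open scoped Matrix

/-- An element of a C⋆-algebra whose imaginary part is `c⋆c` with `c` invertible is invertible. -/
theorem isUnit_of_sub_star_eq {A : Type*} [CStarAlgebra A] {t c : A} (hc : IsUnit c)
    (h : t - star t = (2 * Complex.I) • (star c * c)) : IsUnit t := by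
  obtain ⟨u, rfl⟩ := hc
  set v : A := ↑u⁻¹ with hv
  have huv : (u : A) * v = 1 := u.mul_inv
  have hvu : star v * star (u : A) = 1 := by rw [← star_mul, huv, star_one]
  set k : A := star v * t * v - algebraMap ℂ A Complex.I with hk
  have hself : IsSelfAdjoint k := by
    have h1 : star v * (t - star t) * v = (2 * Complex.I) • (1 : A) := by
      rw [h, mul_smul_comm, smul_mul_assoc, ← mul_assoc, hvu, one_mul, huv]
    have h2 : star k = star v * star t * v + Complex.I • (1 : A) := by
      simp [hk, Algebra.algebraMap_eq_smul_one, mul_assoc]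
    rw [IsSelfAdjoint, h2, hk, Algebra.algebraMap_eq_smul_one, eq_sub_iff_add_eq, add_assoc,
      ← add_smul, ← two_mul, ← h1]
    noncomm_ring
  have hunit : IsUnit (star v * t * v) := by
    by_contra hn
    have hmem : -Complex.I ∈ spectrum ℂ k := by
      rw [spectrum.mem_iff]
      intro hu
      apply hn
      have := hu.neg
      rwa [hk, neg_sub, map_neg, sub_neg_eq_add, sub_add_cancel] at this
    have := hself.im_eq_zero_of_mem_spectrum hmem
    simp at this
  have huv' : star (u : A) * star v = 1 := by rw [← star_mul, hv, u.inv_mul, star_one]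
  have ht : t = star (u : A) * (star v * t * v) * u := by
    rw [← mul_assoc, ← mul_assoc, huv', one_mul, mul_assoc, hv, u.inv_mul, mul_one]
  rw [ht]
  exact (u.isUnit.star.mul hunit).mul u.isUnit

theorem inv_sub_star_inv_eq {A : Type*} [Ring A] [StarRing A] {t v : A} (h1 : t * v = 1) :
    v - star v = - (star v * (t - star t) * v) := by
  have h2 : star v * star t = 1 := by rw [← star_mul, h1, star_one]
  rw [mul_sub, sub_mul, h2, mul_assoc, h1]
  simp

/-- The imaginary part of `t⁻¹` when that of `t` is at least `ε` and `t⋆t ≤ R²`. -/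
theorem neg_inv_sub_star_inv_eq {A : Type*} [Ring A] [StarRing A] [Algebra ℂ A]
    {t v d y : A} {ε R : ℂ} (hR : R ≠ 0) (htv : t * v = 1)
    (ht : t - star t = (2 * Complex.I) • (ε • 1 + star d * d))
    (hy : R ^ 2 • (1 : A) - star t * t = star y * y) :
    -((2 * Complex.I)⁻¹ • (v - star v)) - ((ε / R ^ 2) • (1 : A)) =
      star (d * v) * (d * v) + (ε / R ^ 2) • (star (y * v) * (y * v)) := by
  have h1 : star v * star t = 1 := by rw [← star_mul, htv, star_one]
  have h2 : star (y * v) * (y * v) = R ^ 2 • (star v * v) - 1 := by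
    calc star (y * v) * (y * v) = star v * (star y * y) * v := by rw [star_mul]; noncomm_ring
      _ = R ^ 2 • (star v * v) - (star v * star t) * (t * v) := by
        rw [← hy, mul_sub, sub_mul, mul_smul_comm, smul_mul_assoc, mul_one]; noncomm_ring
      _ = _ := by rw [h1, htv, mul_one]
  have h3 : (2 * Complex.I)⁻¹ • (v - star v) = -(ε • (star v * v) + star (d * v) * (d * v)) := by
    rw [inv_sub_star_inv_eq htv, ht, mul_smul_comm, smul_mul_assoc, smul_neg, smul_smul,
      inv_mul_cancel₀ (by simp), one_smul, mul_add, add_mul, mul_smul_comm, smul_mul_assoc,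
      mul_one, star_mul]
    noncomm_ring
  rw [h2, h3, smul_sub, smul_smul, div_mul_cancel₀ _ (pow_ne_zero 2 hR)]
  abel

section StateSlice

variable {B : Type*} [NormedRing B] [NormedAlgebra ℂ B] [StarRing B] [StarModule ℂ B]
  {m : ℕ} {τ : B →ₗ[ℂ] ℂ}

/-- Positive functionals are hermitian. -/
theorem map_star_of_forall_nonneg (hτ : ∀ b : B, 0 ≤ τ (star b * b)) (b : B) :
    τ (star b) = star (τ b) := by
  have key : ∀ b : B, (τ b).im + (τ (star b)).im = 0 := by
    intro b
    have h0 := (Complex.nonneg_iff.1 (hτ 1)).2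
    have h1 := (Complex.nonneg_iff.1 (hτ b)).2
    have h2 := (Complex.nonneg_iff.1 (hτ (1 + b))).2
    simp only [star_add, add_mul, mul_add, star_one, one_mul, mul_one, map_add,
      Complex.add_im] at h0 h1 h2
    linarith
  have h1 := key b
  have h2 := key (Complex.I • b)
  simp only [star_smul, map_smul, smul_eq_mul, Complex.mul_im, Complex.star_def,
    Complex.conj_I, Complex.I_re, Complex.I_im, Complex.neg_im, Complex.neg_re] at h2
  apply Complex.ext <;> simp <;> linarith

theorem mapMatrix_star_of_forall_nonneg (hτ : ∀ b : B, 0 ≤ τ (star b * b))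
    (z : Matrix (Fin m) (Fin m) B) : τ.mapMatrix (star z) = (τ.mapMatrix z)ᴴ := by
  ext i j
  simp [Matrix.star_apply, map_star_of_forall_nonneg hτ]

/-- Slicing by a positive functional is a positive map. -/
theorem posSemidef_mapMatrix_star_mul_self (hτ : ∀ b : B, 0 ≤ τ (star b * b))
    (z : Matrix (Fin m) (Fin m) B) : (τ.mapMatrix (star z * z)).PosSemidef := by
  refine .of_dotProduct_mulVec_nonneg ?_ fun v => ?_
  · rw [Matrix.IsHermitian, ← mapMatrix_star_of_forall_nonneg hτ, star_mul, star_star]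
  · have : star v ⬝ᵥ (τ.mapMatrix (star z * z)) *ᵥ v =
        ∑ k, τ (star (∑ j, v j • z k j) * ∑ j, v j • z k j) := by
      simp only [dotProduct, Matrix.mulVec, LinearMap.mapMatrix_apply, Matrix.map_apply,
        Matrix.mul_apply, Matrix.star_apply, star_sum, star_smul, Finset.sum_mul,
        Finset.mul_sum, map_sum, smul_mul_assoc, mul_smul_comm, map_smul, smul_eq_mul,
        Pi.star_apply]
      rw [Finset.sum_comm_cycle]
      refine Finset.sum_congr rfl fun k _ => ?_
      rw [Finset.sum_comm]
      refine Finset.sum_congr rfl fun i _ => Finset.sum_congr rfl fun j _ => ?_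
      ring
    rw [this]
    exact Finset.sum_nonneg fun k _ => hτ _

end StateSlice

section MatrixBounds

variable {m : ℕ}

theorem star_dotProduct_mulVec_eq_inner (A : Matrix (Fin m) (Fin m) ℂ) (v : Fin m → ℂ) :
    star v ⬝ᵥ A *ᵥ v = inner ℂ (WithLp.toLp 2 v)
      (Matrix.toEuclideanCLM (𝕜 := ℂ) A (WithLp.toLp 2 v)) := by
  simp [EuclideanSpace.inner_eq_star_dotProduct, dotProduct_comm]

theorem star_dotProduct_self_eq_norm_sq (v : Fin m → ℂ) :
    star v ⬝ᵥ v = ((‖WithLp.toLp 2 v‖ ^ 2 : ℝ) : ℂ) := by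
  have := star_dotProduct_mulVec_eq_inner 1 v
  simpa [inner_self_eq_norm_sq_to_K] using this

open scoped MatrixOrder in
theorem Matrix.PosSemidef.exists_eq_star_mul_self {A : Matrix (Fin m) (Fin m) ℂ}
    (hA : A.PosSemidef) : ∃ C, A = star C * C :=
  CStarAlgebra.nonneg_iff_eq_star_mul_self.mp hA.nonneg

theorem Matrix.PosDef.exists_isUnit_eq_star_mul_self {A : Matrix (Fin m) (Fin m) ℂ}
    (hA : A.PosDef) : ∃ C, IsUnit C ∧ A = star C * C := by
  obtain ⟨C, hC⟩ := hA.posSemidef.exists_eq_star_mul_self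
  refine ⟨C, ?_, hC⟩
  have := hA.isUnit
  rw [Matrix.isUnit_iff_isUnit_det, hC, Matrix.det_mul] at this
  exact (Matrix.isUnit_iff_isUnit_det _).2 (isUnit_of_mul_isUnit_right this)

/-- A positive definite matrix `A` satisfies `A ≥ ‖A⁻¹‖⁻¹`. -/
theorem Matrix.PosDef.posSemidef_sub_inv_norm_inv {A : Matrix (Fin m) (Fin m) ℂ}
    (hA : A.PosDef) :
    (A - ((‖Matrix.toEuclideanCLM (𝕜 := ℂ) A⁻¹‖⁻¹ : ℝ) : ℂ) • 1).PosSemidef := by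
  obtain ⟨C, hCu, rfl⟩ := hA.exists_isUnit_eq_star_mul_self
  have hdet := (Matrix.isUnit_iff_isUnit_det _).1 hCu
  set φ := Matrix.toEuclideanCLM (n := Fin m) (𝕜 := ℂ)
  have hnorm : ‖φ (star C * C)⁻¹‖ = ‖φ C⁻¹‖ * ‖φ C⁻¹‖ := by
    rw [Matrix.mul_inv_rev, Matrix.star_eq_conjTranspose, ← Matrix.conjTranspose_nonsing_inv,
      ← Matrix.star_eq_conjTranspose, map_mul, map_star]
    exact CStarRing.norm_self_mul_star
  refine .of_dotProduct_mulVec_nonneg ?_ fun v => ?_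
  · refine hA.isHermitian.sub ?_
    simp [Matrix.IsHermitian, Matrix.conjTranspose_smul]
  · have h1 : star v ⬝ᵥ (star C * C) *ᵥ v = ((‖WithLp.toLp 2 (C *ᵥ v)‖ ^ 2 : ℝ) : ℂ) := by
      rw [← star_dotProduct_self_eq_norm_sq, ← Matrix.mulVec_mulVec, Matrix.dotProduct_mulVec,
        Matrix.star_eq_conjTranspose, Matrix.vecMul_conjTranspose, star_star]
    have h2 : ‖WithLp.toLp 2 v‖ ≤ ‖φ C⁻¹‖ * ‖WithLp.toLp 2 (C *ᵥ v)‖ := by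
      have := (φ C⁻¹).le_opNorm (WithLp.toLp 2 (C *ᵥ v))
      rwa [Matrix.toEuclideanCLM_toLp, Matrix.mulVec_mulVec, Matrix.nonsing_inv_mul _ hdet,
        Matrix.one_mulVec] at this
    rw [Matrix.sub_mulVec, dotProduct_sub, h1, Matrix.smul_mulVec, Matrix.one_mulVec,
      dotProduct_smul, star_dotProduct_self_eq_norm_sq, smul_eq_mul, ← Complex.ofReal_mul,
      ← Complex.ofReal_sub, Complex.zero_le_real, sub_nonneg, hnorm]
    rcases (norm_nonneg (φ C⁻¹)).eq_or_lt with h0 | h0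
    · rw [← h0]; simp
    · rw [inv_mul_le_iff₀ (mul_pos h0 h0)]
      have h3 := pow_le_pow_left₀ (norm_nonneg _) h2 2
      rwa [mul_pow, pow_two ‖φ C⁻¹‖] at h3

theorem star_dotProduct_matIm_mulVec (G : Matrix (Fin m) (Fin m) ℂ) (v : Fin m → ℂ) :
    star v ⬝ᵥ matIm G *ᵥ v = ((star v ⬝ᵥ G *ᵥ v).im : ℂ) := by
  have h : star v ⬝ᵥ Gᴴ *ᵥ v = star (star v ⬝ᵥ G *ᵥ v) := by
    rw [← Matrix.star_dotProduct, Matrix.star_mulVec, Matrix.dotProduct_mulVec]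
  rw [matIm, Matrix.smul_mulVec, dotProduct_smul, Matrix.sub_mulVec, dotProduct_sub, h,
    smul_eq_mul, Complex.star_def, Complex.sub_conj]
  push_cast
  field_simp

/-- A matrix with `-Im G ≥ δ > 0` is bounded below by `δ`. -/
theorem le_norm_toEuclideanCLM_of_posSemidef {G : Matrix (Fin m) (Fin m) ℂ} {δ : ℝ}
    (h : (-matIm G - δ • (1 : Matrix (Fin m) (Fin m) ℂ)).PosSemidef)
    (v : EuclideanSpace ℂ (Fin m)) : δ * ‖v‖ ≤ ‖Matrix.toEuclideanCLM (𝕜 := ℂ) G v‖ := by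
  have h1 := h.dotProduct_mulVec_nonneg v.ofLp
  rw [Matrix.sub_mulVec, dotProduct_sub, Matrix.neg_mulVec, dotProduct_neg,
    star_dotProduct_matIm_mulVec, Matrix.smul_mulVec, Matrix.one_mulVec, dotProduct_smul,
    star_dotProduct_self_eq_norm_sq, star_dotProduct_mulVec_eq_inner, Complex.real_smul,
    ← Complex.ofReal_mul, ← Complex.ofReal_neg, ← Complex.ofReal_sub, Complex.zero_le_real,
    WithLp.toLp_ofLp] at h1
  have h2 : δ * ‖v‖ ^ 2 ≤ ‖v‖ * ‖Matrix.toEuclideanCLM (𝕜 := ℂ) G v‖ := by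
    have h3 := Complex.abs_im_le_norm (inner ℂ v (Matrix.toEuclideanCLM (𝕜 := ℂ) G v))
    have h4 := norm_inner_le_norm (𝕜 := ℂ) v (Matrix.toEuclideanCLM (𝕜 := ℂ) G v)
    have h5 := neg_abs_le (inner ℂ v (Matrix.toEuclideanCLM (𝕜 := ℂ) G v)).im
    linarith
  rcases (norm_nonneg v).eq_or_lt with h0 | h0
  · rw [← h0]; simp
  · exact le_of_mul_le_mul_left (by linarith) h0

theorem isUnit_of_posSemidef_neg_matIm_sub {G : Matrix (Fin m) (Fin m) ℂ} {δ : ℝ} (hδ : 0 < δ)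
    (h : (-matIm G - δ • (1 : Matrix (Fin m) (Fin m) ℂ)).PosSemidef) : IsUnit G := by
  rw [← Matrix.mulVec_injective_iff_isUnit]
  refine (injective_iff_map_eq_zero G.mulVecLin).2 fun v hv => ?_
  have := le_norm_toEuclideanCLM_of_posSemidef h (WithLp.toLp 2 v)
  rw [Matrix.toEuclideanCLM_toLp, ← Matrix.mulVecLin_apply, hv, WithLp.toLp_zero, norm_zero] at this
  have h0 : ‖WithLp.toLp 2 v‖ ≤ 0 := nonpos_of_mul_nonpos_right this hδ
  simpa using h0

theorem norm_toEuclideanCLM_inv_le_of_posSemidef {G : Matrix (Fin m) (Fin m) ℂ} {δ : ℝ}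
    (hδ : 0 < δ) (h : (-matIm G - δ • (1 : Matrix (Fin m) (Fin m) ℂ)).PosSemidef) :
    ‖Matrix.toEuclideanCLM (𝕜 := ℂ) G⁻¹‖ ≤ δ⁻¹ := by
  have hdet := (Matrix.isUnit_iff_isUnit_det _).1 (isUnit_of_posSemidef_neg_matIm_sub hδ h)
  refine ContinuousLinearMap.opNorm_le_bound _ (by positivity) fun v => ?_
  have := le_norm_toEuclideanCLM_of_posSemidef h (Matrix.toEuclideanCLM (𝕜 := ℂ) G⁻¹ v)
  rw [← mul_apply_eq_comp, ← map_mul, Matrix.mul_nonsing_inv _ hdet, map_one,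
    one_apply_eq_self] at this
  rwa [inv_mul_eq_div, le_div_iff₀' hδ]

end MatrixBounds

section MatrixAlgebra

variable {B : Type*} [NormedRing B] [NormedAlgebra ℂ B] [StarRing B] [StarModule ℂ B] {m : ℕ}

theorem mapMatrix_ofId_star (C : Matrix (Fin m) (Fin m) ℂ) :
    (Algebra.ofId ℂ B).mapMatrix (star C) = star ((Algebra.ofId ℂ B).mapMatrix C) := by
  ext i j
  simp only [AlgHom.mapMatrix_apply, Matrix.map_apply, Matrix.star_apply, Algebra.ofId_apply,
    algebraMap_star_comm]

/-- Matrices over a C⋆-algebra whose imaginary part is `c⋆c` with `c` invertible are invertible. -/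
theorem Matrix.isUnit_of_sub_star_eq [CompleteSpace B] [CStarRing B]
    {t c : Matrix (Fin m) (Fin m) B} (hc : IsUnit c)
    (h : t - star t = (2 * Complex.I) • (star c * c)) : IsUnit t := by
  let : CStarAlgebra B := {}
  let := CStarAlgebra.spectralOrder B
  have := CStarAlgebra.spectralOrderedRing B
  let φ : Matrix (Fin m) (Fin m) B ≃⋆ₐ[ℂ] CStarMatrix (Fin m) (Fin m) B :=
    CStarMatrix.ofMatrixStarAlgEquiv
  have hφ : IsUnit (φ t) := by
    refine _root_.isUnit_of_sub_star_eq (c := φ c) (hc.map φ) ?_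
    rw [← map_star, ← map_star, ← map_sub, ← map_mul, ← map_smul, h]
  simpa using hφ.map φ.symm

end MatrixAlgebra

/-- Let `a₀,…,a_r` be self-adjoint `m×m` matrices, `x₁,…,x_r` self-adjoint
elements of a unital C*-algebra `B` with a state `τ`, and
`s = a₀ ⊗ 1 + Σᵢ aᵢ ⊗ xᵢ ∈ M_m(ℂ) ⊗ B = M_m(B)`.  For `λ ∈ M_m(ℂ)` with `Im λ` positive
definite, `T = λ ⊗ 1 - s` is invertible; and if `R` bounds the norm of `T` in the C*-algebra
`M_m(B)` (expressed by positivity of `R²·1 - T*T`), then, with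
`G(λ) = (id_m ⊗ τ)[T⁻¹]`, one has `-Im G(λ) ≥ (R²·‖(Im λ)⁻¹‖)⁻¹·1`; in particular `G(λ)` is
invertible with `‖G(λ)⁻¹‖ ≤ R²·‖(Im λ)⁻¹‖`. -/
theorem stmt18 {B : Type*} [NormedRing B] [NormedAlgebra ℂ B] [CompleteSpace B]
    [StarRing B] [CStarRing B] [StarModule ℂ B]
    (m r : ℕ) (hm : 0 < m)
    (a0 : Matrix (Fin m) (Fin m) ℂ) (a : Fin r → Matrix (Fin m) (Fin m) ℂ)
    (ha0 : a0.IsHermitian) (ha : ∀ i, (a i).IsHermitian)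
    (x : Fin r → B) (hx : ∀ i, IsSelfAdjoint (x i))
    (τ : B →ₗ[ℂ] ℂ) (hτ1 : τ 1 = 1) (hτpos : ∀ b : B, 0 ≤ τ (star b * b))
    (lam : Matrix (Fin m) (Fin m) ℂ) (hlam : (matIm lam).PosDef)
    (T : Matrix (Fin m) (Fin m) B)
    (hT : T = Matrix.of (fun k l => algebraMap ℂ B (lam k l)) -
      (Matrix.of (fun k l => algebraMap ℂ B (a0 k l)) +
        ∑ i, Matrix.of fun k l => (a i k l) • x i))
    (G : Matrix (Fin m) (Fin m) ℂ)
    (hG : G = Matrix.of fun k l => τ (Ring.inverse T k l))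
    (R : ℝ) (hR : 0 ≤ R)
    (hRnorm : ∃ y : Matrix (Fin m) (Fin m) B,
      ((R : ℂ) ^ 2) • (1 : Matrix (Fin m) (Fin m) B) - star T * T = star y * y) :
    IsUnit T ∧
      (((-matIm G) -
          ((R ^ 2 * ‖Matrix.toEuclideanCLM (𝕜 := ℂ) (matIm lam)⁻¹‖)⁻¹ : ℝ) •
            (1 : Matrix (Fin m) (Fin m) ℂ)).PosSemidef) ∧
      IsUnit G ∧
      ‖Matrix.toEuclideanCLM (𝕜 := ℂ) G⁻¹‖ ≤
        R ^ 2 * ‖Matrix.toEuclideanCLM (𝕜 := ℂ) (matIm lam)⁻¹‖ := by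
  set ι := (Algebra.ofId ℂ B).mapMatrix (m := Fin m) with hι
  set N : ℝ := ‖Matrix.toEuclideanCLM (𝕜 := ℂ) (matIm lam)⁻¹‖ with hN
  have hTsub : T - star T = (2 * Complex.I) • ι (matIm lam) := by
    have hs : star (Matrix.of (fun k l => algebraMap ℂ B (a0 k l)) +
        ∑ i, Matrix.of fun k l => (a i k l) • x i) =
        Matrix.of (fun k l => algebraMap ℂ B (a0 k l)) +
        ∑ i, Matrix.of fun k l => (a i k l) • x i := by
      rw [star_add, star_sum]
      congr 1
      · ext k l
        simp [Matrix.star_apply, ← algebraMap_star_comm, ← ha0.apply k l]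
      · refine Finset.sum_congr rfl fun i _ => ?_
        ext k l
        simp [Matrix.star_apply, (hx i).star_eq, ← (ha i).apply k l]
    have hl : Matrix.of (fun k l => algebraMap ℂ B (lam k l)) = ι lam := rfl
    rw [hT, star_sub, hs, hl, sub_sub_sub_cancel_right, hι, ← mapMatrix_ofId_star, ← map_sub,
      ← map_smul, matIm, smul_inv_smul₀ (by simp), Matrix.star_eq_conjTranspose]
  obtain ⟨C, hCu, hC⟩ := hlam.exists_isUnit_eq_star_mul_self
  have hTu : IsUnit T := by
    refine Matrix.isUnit_of_sub_star_eq (hCu.map ι) ?_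
    rw [hTsub, hC, map_mul, hι, mapMatrix_ofId_star]
  set V := Ring.inverse T with hV
  have hTV : T * V = 1 := Ring.mul_inverse_cancel T hTu
  have hΦ1 : τ.mapMatrix (1 : Matrix (Fin m) (Fin m) B) = 1 := by
    ext i j
    simp [Matrix.one_apply, apply_ite τ, hτ1]
  obtain ⟨y, hy⟩ := hRnorm
  have hR0 : R ≠ 0 := by
    rintro rfl
    have h1 : star (y * V) * (y * V) = -1 := by
      calc star (y * V) * (y * V) = star V * (star y * y) * V := by rw [star_mul]; noncomm_ring
        _ = -(star (T * V) * (T * V)) := by rw [← hy, star_mul]; simp [mul_assoc]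
        _ = -1 := by simp [hTV]
    have h2 := (posSemidef_mapMatrix_star_mul_self hτpos (y * V)).diag_nonneg (i := ⟨0, hm⟩)
    rw [h1, map_neg, hΦ1] at h2
    simp at h2
    norm_num at h2
  have hN0 : 0 < N := by
    have : Nonempty (Fin m) := ⟨⟨0, hm⟩⟩
    refine norm_pos_iff.2 fun h => ?_
    have h0 : (matIm lam)⁻¹ = 0 := by simpa using h
    have := hlam.inv.isUnit
    rw [h0] at this
    exact not_isUnit_zero this
  have hδ : 0 < (R ^ 2 * N)⁻¹ := by positivity
  obtain ⟨D, hD⟩ := hlam.posSemidef_sub_inv_norm_inv.exists_eq_star_mul_self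
  have key := neg_inv_sub_star_inv_eq (d := ι D) (ε := ((N⁻¹ : ℝ) : ℂ))
    (Complex.ofReal_ne_zero.2 hR0) hTV
    (by rw [hTsub, eq_add_of_sub_eq' hD, map_add, map_smul, map_one, map_mul, hι,
      mapMatrix_ofId_star]) hy
  have hpos : (-matIm G - (R ^ 2 * N)⁻¹ • (1 : Matrix (Fin m) (Fin m) ℂ)).PosSemidef := by
    have hcoe : ((N⁻¹ : ℝ) : ℂ) / (R : ℂ) ^ 2 = (((R ^ 2 * N)⁻¹ : ℝ) : ℂ) := by
      push_cast
      field_simp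
    have hGV : G = τ.mapMatrix V := hG
    have := congrArg τ.mapMatrix key
    rw [map_sub, map_neg, map_smul, map_sub, mapMatrix_star_of_forall_nonneg hτpos, ← hGV, ← matIm,
      map_smul, hΦ1, map_add, map_smul, hcoe, Complex.coe_smul, Complex.coe_smul] at this
    rw [this]
    exact (posSemidef_mapMatrix_star_mul_self hτpos _).add
      ((posSemidef_mapMatrix_star_mul_self hτpos _).smul hδ.le)
  refine ⟨hTu, hpos, isUnit_of_posSemidef_neg_matIm_sub hδ hpos, ?_⟩
  simpa only [inv_inv] using norm_toEuclideanCLM_inv_le_of_posSemidef hδ hpos
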